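/- arXiv:math/0312478 — 2 statements merged into one kernel-verified Lean document; each statement's English description precedes it below -/
import Mathlib

section
/- For a partition μ of N, the hook length formula for the Kostka polynomial at μ = column shape holds: K_{μ,(1^N)}(q) = q^{n(μ')} · (q)_N / ∏_{x∈μ} (1 − q^{h(x)}), where the product runs over boxes x of the Young diagram of μ, h(x) is the hook length, n(μ') = Σ_i binom(μ_i, 2), and (q)_N = ∏_{i=1}^N (1 − q^i). -/
open Polynomial Finset
open scoped Classical

/-- `T k` is the cell (row, column) containing the entry `k` of a standard Young
tableau with `N` boxes, of shape `μ` (cells fit inside an `N × N` box). `IsSYT`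
says that `T` is a bijection onto the cells of `μ` and that entries increase
along rows and down columns. -/
def IsSYT (N : ℕ) (μ : ℕ → ℕ) (T : Fin N → Fin N × Fin N) : Prop :=
  (∀ k, ((T k).2 : ℕ) < μ ((T k).1 : ℕ)) ∧
  Function.Injective T ∧
  (∀ i j : Fin N, (j : ℕ) < μ (i : ℕ) → ∃ k, T k = (i, j)) ∧
  (∀ k l : Fin N, (T k).1 ≤ (T l).1 → (T k).2 ≤ (T l).2 → T k ≠ T l → k < l)

/-- Position of a cell in the reading word of the tableau (rows read from the
bottom row upwards, each row from left to right). -/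
def readPos (N : ℕ) (μ : ℕ → ℕ) (c : Fin N × Fin N) : ℕ :=
  (∑ i ∈ Finset.Ico ((c.1 : ℕ) + 1) N, μ i) + (c.2 : ℕ)

/-- The charge indices of a standard word: `c_1 = 0`, and
`c_{r+1} = c_r + 1` exactly when the entry `r+1` lies to the right of the entry
`r` in the reading word; `p r` is the position of entry `r`. -/
def chargeAux (p : ℕ → ℕ) : ℕ → ℕ
  | 0 => 0
  | r + 1 => chargeAux p r + (if p r < p (r + 1) then 1 else 0)

/-- The charge of a standard Young tableau: the sum of the charge indices of its
reading word. -/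
noncomputable def charge (N : ℕ) (μ : ℕ → ℕ) (T : Fin N → Fin N × Fin N) : ℕ :=
  ∑ r ∈ Finset.range N,
    chargeAux (fun k => if h : k < N then readPos N μ (T ⟨k, h⟩) else 0) r

/-- The Kostka–Foulkes polynomial `K_{μ,(1^N)}(q) = Σ_{T ∈ SYT(μ)} q^{charge T}`. -/
noncomputable def kostkaColumn (N : ℕ) (μ : ℕ → ℕ) : Polynomial ℤ :=
  ∑ T ∈ Finset.univ.filter (IsSYT N μ), Polynomial.X ^ charge N μ T

/-- The conjugate partition `μ'`: `μ'_j = #{i | μ_i > j}` (0-indexed). -/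
def conjPart (N : ℕ) (μ : ℕ → ℕ) (j : ℕ) : ℕ :=
  ((Finset.range N).filter fun i => j < μ i).card

/-- The hook length of the (0-indexed) cell `(i,j)` of `μ`. -/
def hook (N : ℕ) (μ : ℕ → ℕ) (i j : ℕ) : ℕ :=
  μ i + conjPart N μ j - i - j - 1
/-- `e k = q^{k choose 2} / (q)_k`, extended by zero to negative `k`. -/
noncomputable def elemSpec {K : Type*} [Field K] (q : K) (k : ℤ) : K :=
  if 0 ≤ k then q ^ (k.toNat.choose 2) / ∏ i ∈ range k.toNat, (1 - q ^ (i + 1)) else 0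

theorem elemSpec_of_neg {K : Type*} [Field K] (q : K) {k : ℤ} (hk : k < 0) :
    elemSpec q k = 0 := by
  simp [elemSpec, not_le.2 hk]

theorem elemSpec_zero {K : Type*} [Field K] (q : K) : elemSpec q 0 = 1 := by
  simp [elemSpec]

theorem elemSpec_natCast {K : Type*} [Field K] (q : K) (n : ℕ) :
    elemSpec q n = q ^ (n.choose 2) / ∏ i ∈ range n, (1 - q ^ (i + 1)) := by
  simp [elemSpec]

theorem elemSpec_rec {K : Type*} [Field K] {q : K} (hq0 : q ≠ 0)
    (hq : ∀ k : ℕ, 1 - q ^ (k + 1) ≠ 0) (k : ℤ) :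
    elemSpec q k = q ^ k * elemSpec q k + q ^ (k - 1) * elemSpec q (k - 1) := by
  rcases lt_trichotomy k 0 with h | rfl | h
  · rw [elemSpec_of_neg q h, elemSpec_of_neg q (by omega : k - 1 < 0)]; simp
  · rw [elemSpec_zero, elemSpec_of_neg q (by norm_num)]; simp
  · obtain ⟨n, rfl⟩ : ∃ n : ℕ, k = ((n + 1 : ℕ) : ℤ) := ⟨(k - 1).toNat, by omega⟩
    have h1 : ((n + 1 : ℕ) : ℤ) - 1 = n := by push_cast; ring
    rw [h1, elemSpec_natCast, elemSpec_natCast, prod_range_succ, zpow_natCast, zpow_natCast,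
      Nat.choose_succ_succ', Nat.choose_one_right, pow_add]
    have h2 := hq n
    have h3 : ∏ i ∈ range n, (1 - q ^ (i + 1)) ≠ 0 := prod_ne_zero_iff.2 fun i _ => hq i
    field_simp
    ring

/-- The dual Jacobi–Trudi determinant of `μ / ν`, the columns of index less than `r` being
specialised at `q, q², …` and the other ones at `1, q, q², …`. -/
noncomputable def jtDet {K : Type*} [Field K] (q : K) {N : ℕ} (μ ν : Fin N → ℕ) (r : ℕ) : K :=
  Matrix.det (Matrix.of fun i j : Fin N =>
    (if (j : ℕ) < r then q ^ ((μ i - i : ℤ) - (ν j - j)) else 1) *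
      elemSpec q ((μ i - i : ℤ) - (ν j - j)))

theorem jtDet_step {K : Type*} [Field K] {q : K} (hq0 : q ≠ 0)
    (hq : ∀ k : ℕ, 1 - q ^ (k + 1) ≠ 0) {N : ℕ} (μ ν : Fin N → ℕ) (r : Fin N) :
    jtDet q μ ν r = jtDet q μ ν (r + 1) + jtDet q μ (Function.update ν r (ν r + 1)) (r + 1) := by
  set A := Matrix.of fun i j : Fin N =>
    (if (j : ℕ) < r then q ^ ((μ i - i : ℤ) - (ν j - j)) else 1) *
      elemSpec q ((μ i - i : ℤ) - (ν j - j)) with hA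
  have key := Matrix.det_updateCol_add A r
    (fun i => q ^ ((μ i - i : ℤ) - (ν r - r)) * elemSpec q ((μ i - i : ℤ) - (ν r - r)))
    (fun i => q ^ ((μ i - i : ℤ) - (ν r - r) - 1) * elemSpec q ((μ i - i : ℤ) - (ν r - r) - 1))
  have hlt : ∀ j : Fin N, j ≠ r → ((j : ℕ) < r + 1 ↔ (j : ℕ) < r) := by
    intro j hj
    have : (j : ℕ) ≠ r := fun h => hj (Fin.ext h)
    omega
  unfold jtDet
  convert key using 2
  · ext i j
    rcases eq_or_ne j r with rfl | h
    · simpa [Matrix.updateCol_apply] using elemSpec_rec hq0 hq _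
    · simp [hA, h]
  · congr 1
    ext i j
    rcases eq_or_ne j r with rfl | h
    · simp
    · simp only [hA, Matrix.updateCol_apply, Matrix.of_apply, if_neg h, hlt j h]
  · congr 1
    ext i j
    rcases eq_or_ne j r with rfl | h
    · have : (μ i - i : ℤ) - (((ν j + 1 : ℕ) : ℤ) - j) = (μ i - i : ℤ) - (ν j - j) - 1 := by
        push_cast; ring
      simp only [Matrix.updateCol_apply, Matrix.of_apply, Function.update_self, this]
      simp
    · simp only [hA, Matrix.updateCol_apply, Matrix.of_apply, if_neg h, hlt j h,
        Function.update_of_ne h]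

theorem jtDet_last {K : Type*} [Field K] {q : K} (hq0 : q ≠ 0) {N M : ℕ} (μ ν : Fin N → ℕ)
    (h : ∑ i, ν i + M = ∑ i, μ i) : jtDet q μ ν N = q ^ M * jtDet q μ ν 0 := by
  unfold jtDet
  have h1 : (Matrix.of fun i j : Fin N =>
      (if (j : ℕ) < N then q ^ ((μ i - i : ℤ) - (ν j - j)) else 1) *
        elemSpec q ((μ i - i : ℤ) - (ν j - j))) =
      Matrix.of fun i j : Fin N => q ^ (μ i - i : ℤ) * (Matrix.of (fun i j : Fin N =>
        q ^ (-(ν j - j : ℤ)) * (Matrix.of (fun i j : Fin N =>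
          (if (j : ℕ) < 0 then q ^ ((μ i - i : ℤ) - (ν j - j)) else 1) *
            elemSpec q ((μ i - i : ℤ) - (ν j - j)))) i j)) i j := by
    ext i j
    simp only [Matrix.of_apply, Fin.is_lt, if_true, Nat.not_lt_zero, if_false, one_mul]
    rw [sub_eq_add_neg (μ i - i : ℤ), zpow_add₀ hq0, mul_assoc]
  rw [h1, Matrix.det_mul_column, Matrix.det_mul_row, ← mul_assoc, ← prod_mul_distrib]
  congr 1
  simp_rw [← zpow_add₀ hq0]
  rw [← zpow_natCast]
  have hs : ∀ (s : Finset (Fin N)) (f : Fin N → ℤ), ∏ i ∈ s, q ^ f i = q ^ ∑ i ∈ s, f i := by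
    intro s f
    induction s using Finset.induction_on with
    | empty => simp
    | insert a s ha ih => rw [prod_insert ha, sum_insert ha, zpow_add₀ hq0, ih]
  rw [hs]
  congr 1
  have : (∑ i, (ν i : ℤ)) + M = ∑ i, (μ i : ℤ) := by exact_mod_cast h
  simp only [sum_add_distrib, sum_sub_distrib, sum_neg_distrib]
  linarith

theorem jtDet_update_eq_zero {K : Type*} [Field K] (q : K) {N : ℕ} (μ ν : Fin N → ℕ)
    (hν : Antitone ν) (r : Fin N) (h : ¬ Antitone (Function.update ν r (ν r + 1))) :
    jtDet q μ (Function.update ν r (ν r + 1)) (r + 1) = 0 := by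
  obtain ⟨s, hs, hsν⟩ : ∃ s : Fin N, (s : ℕ) + 1 = r ∧ ν s = ν r := by
    simp only [Antitone, not_forall, not_le] at h
    obtain ⟨a, b, hab, hlt⟩ := h
    have h0 := hν hab
    have hbr : b = r := by
      by_contra hb
      rw [Function.update_of_ne hb] at hlt
      rcases eq_or_ne a r with rfl | ha
      · rw [Function.update_self] at hlt; omega
      · rw [Function.update_of_ne ha] at hlt; omega
    subst hbr
    have ha : a ≠ b := by rintro rfl; exact lt_irrefl _ hlt
    rw [Function.update_self, Function.update_of_ne ha] at hlt
    have hab' : (a : ℕ) < b := lt_of_le_of_ne hab (fun h => ha (Fin.ext h))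
    refine ⟨⟨b - 1, by omega⟩, by simp; omega, ?_⟩
    have h1 := hν (show a ≤ ⟨b - 1, by omega⟩ by rw [Fin.le_def]; simp; omega)
    have h2 := hν (show (⟨b - 1, by omega⟩ : Fin N) ≤ b by rw [Fin.le_def]; simp)
    omega
  have hne : s ≠ r := by rintro rfl; omega
  refine Matrix.det_zero_of_column_eq hne fun i => ?_
  have : (μ i - i : ℤ) - (((ν r + 1 : ℕ) : ℤ) - r) = (μ i - i : ℤ) - (ν s - s) := by
    rw [← hs, hsν]; push_cast; ring
  simp only [Matrix.of_apply, Function.update_self, Function.update_of_ne hne, this]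
  simp [show (s : ℕ) < r + 1 by omega]

theorem jtDet_of_sum_eq {K : Type*} [Field K] (q : K) {N : ℕ} (μ ν : Fin N → ℕ)
    (hμ : Antitone μ) (hν : Antitone ν) (h : ∑ i, ν i = ∑ i, μ i) (r : ℕ) :
    jtDet q μ ν r = if ν = μ then 1 else 0 := by
  have hanti : ∀ f : Fin N → ℕ, Antitone f → StrictAnti fun i : Fin N => (f i - i : ℤ) := by
    intro f hf a b hab
    have h1 := hf hab.le
    have h2 : (a : ℕ) < b := hab
    simp only
    omega
  have key : ∀ σ : Equiv.Perm (Fin N),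
      (∀ j, 0 ≤ ((μ (σ j) - (σ j : ℕ) : ℤ) - (ν j - (j : ℕ)))) → σ = 1 ∧ ν = μ := by
    intro σ hσ
    have hsum : ∑ j, ((μ (σ j) - (σ j : ℕ) : ℤ) - (ν j - (j : ℕ))) = 0 := by
      rw [sum_sub_distrib, Equiv.sum_comp σ (fun i : Fin N => (μ i - (i : ℕ) : ℤ))]
      have : (∑ i, (ν i : ℤ)) = ∑ i, (μ i : ℤ) := by exact_mod_cast h
      simp only [sum_sub_distrib]
      linarith
    have heq := (sum_eq_zero_iff_of_nonneg fun j _ => hσ j).1 hsum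
    have hmono : StrictMono σ := by
      intro a b hab
      have h1 := hanti ν hν hab
      have h2 := heq a (mem_univ _)
      have h3 := heq b (mem_univ _)
      refine (hanti μ hμ).lt_iff_gt.1 ?_
      dsimp only at h1 ⊢
      omega
    have hσ1 : σ = 1 := by
      have := Subsingleton.elim (hmono.orderIsoOfSurjective _ σ.surjective) (OrderIso.refl _)
      ext i
      exact congrArg (fun f : Fin N ≃o Fin N => ((f i : Fin N) : ℕ)) this
    subst hσ1
    refine ⟨rfl, funext fun j => ?_⟩
    have := heq j (mem_univ _)
    simp only [Equiv.Perm.coe_one, id_eq] at this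
    omega
  have hz : ∀ σ : Equiv.Perm (Fin N), ¬ (σ = 1 ∧ ν = μ) →
      ∏ j : Fin N, (if (j : ℕ) < r then q ^ ((μ (σ j) - (σ j : ℕ) : ℤ) - (ν j - j)) else 1) *
        elemSpec q ((μ (σ j) - (σ j : ℕ) : ℤ) - (ν j - j)) = 0 := by
    intro σ hσ
    obtain ⟨j, hj⟩ := not_forall.1 (mt (key σ) hσ)
    refine prod_eq_zero (mem_univ j) ?_
    rw [elemSpec_of_neg q (not_le.1 hj), mul_zero]
  rw [jtDet, Matrix.det_apply]
  simp only [Matrix.of_apply]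
  split_ifs with hνμ
  · subst hνμ
    rw [sum_eq_single 1]
    · simp [elemSpec_zero]
    · intro σ _ hσ
      rw [hz σ (by simp [hσ]), smul_zero]
    · simp
  · exact sum_eq_zero fun σ _ => by rw [hz σ (by simp [hνμ]), smul_zero]

/-- Normalised generating function, by charge, of the ways to grow `ν` to `μ` by adding `M` boxes
one at a time, the index `r` recording that the box added previously lies in row `r - 1`. -/
noncomputable def growthGF {K : Type*} [Field K] (q : K) {N : ℕ} (μ : Fin N → ℕ) :
    ℕ → (Fin N → ℕ) → ℕ → K
  | 0, ν, _ => if ν = μ then 1 else 0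
  | M + 1, ν, r => ∑ s : Fin N, if Antitone (Function.update ν s (ν s + 1)) then
      (if (s : ℕ) < r then q ^ (M + 1) else 1) / (1 - q ^ (M + 1)) *
        growthGF q μ M (Function.update ν s (ν s + 1)) (s + 1) else 0

theorem growthGF_step {K : Type*} [Field K] {q : K}
    (hq : ∀ k : ℕ, 1 - q ^ (k + 1) ≠ 0) {N : ℕ} (μ ν : Fin N → ℕ) (M : ℕ) (r : Fin N) :
    growthGF q μ (M + 1) ν r = growthGF q μ (M + 1) ν (r + 1) +
      if Antitone (Function.update ν r (ν r + 1)) then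
        growthGF q μ M (Function.update ν r (ν r + 1)) (r + 1) else 0 := by
  rw [← sub_eq_iff_eq_add', growthGF, growthGF, ← sum_sub_distrib, sum_eq_single r]
  · have := hq M
    simp only [lt_irrefl, if_false, Nat.lt_succ_self, if_true]
    split_ifs
    · field_simp
    · simp
  · intro s _ hs
    have : (s : ℕ) ≠ r := fun h => hs (Fin.ext h)
    have h2 : ((s : ℕ) < r + 1 ↔ (s : ℕ) < r) := by omega
    simp [h2]
  · simp

theorem growthGF_last {K : Type*} [Field K] (q : K) {N : ℕ} (μ ν : Fin N → ℕ) (M : ℕ) :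
    growthGF q μ (M + 1) ν N = q ^ (M + 1) * growthGF q μ (M + 1) ν 0 := by
  simp only [growthGF, mul_sum, Fin.is_lt, if_true, Nat.not_lt_zero, if_false]
  refine sum_congr rfl fun s _ => ?_
  split_ifs
  · ring
  · simp

theorem jtDet_eq_growthGF {K : Type*} [Field K] {q : K} (hq0 : q ≠ 0)
    (hq : ∀ k : ℕ, 1 - q ^ (k + 1) ≠ 0) {N : ℕ} (μ : Fin N → ℕ) (hμ : Antitone μ) (M : ℕ) :
    ∀ (ν : Fin N → ℕ), Antitone ν → ∑ i, ν i + M = ∑ i, μ i → ∀ r ≤ N,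
      jtDet q μ ν r = growthGF q μ M ν r := by
  induction M with
  | zero =>
    intro ν hν hs r _
    rw [jtDet_of_sum_eq q μ ν hμ hν (by simpa using hs), growthGF]
  | succ M ih =>
    intro ν hν hs
    set D : ℕ → K := fun r => jtDet q μ ν r - growthGF q μ (M + 1) ν r with hD
    have hstep : ∀ r < N, D (r + 1) = D r := by
      intro r hr
      have h1 := jtDet_step hq0 hq μ ν ⟨r, hr⟩
      have h2 := growthGF_step hq μ ν M ⟨r, hr⟩
      have h3 : jtDet q μ (Function.update ν ⟨r, hr⟩ (ν ⟨r, hr⟩ + 1)) (r + 1) =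
          if Antitone (Function.update ν ⟨r, hr⟩ (ν ⟨r, hr⟩ + 1)) then
            growthGF q μ M (Function.update ν ⟨r, hr⟩ (ν ⟨r, hr⟩ + 1)) (r + 1) else 0 := by
        split_ifs with h
        · refine ih _ h ?_ _ hr
          rw [← hs, sum_update_of_mem (mem_univ _), sum_eq_add_sum_sdiff_singleton_of_mem
            (mem_univ (⟨r, hr⟩ : Fin N)) ν]
          ring
        · exact jtDet_update_eq_zero q μ ν hν ⟨r, hr⟩ h
      simp only [hD]
      simp only at h1 h2
      rw [h1, h2, h3]
      ring
    have hconst : ∀ r ≤ N, D r = D 0 := by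
      intro r hr
      induction r with
      | zero => rfl
      | succ r ihr => rw [hstep r hr, ihr (by omega)]
    have hlast : D N = q ^ (M + 1) * D 0 := by
      simp only [hD, jtDet_last hq0 μ ν hs, growthGF_last]
      ring
    have h0 : D 0 = 0 := by
      have : (1 - q ^ (M + 1)) * D 0 = 0 := by
        rw [sub_mul, one_mul, ← hlast, hconst N le_rfl, sub_self]
      exact (mul_eq_zero.1 this).resolve_left (hq M)
    intro r hr
    exact sub_eq_zero.1 ((hconst r hr).trans h0)

theorem elemSpec_sub {K : Type*} [Field K] {q : K} (hq0 : q ≠ 0)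
    (hq : ∀ k : ℕ, 1 - q ^ (k + 1) ≠ 0) (L b : ℕ) :
    elemSpec q ((L : ℤ) - b) = q ^ (L.choose 2) / (∏ i ∈ range L, (1 - q ^ (i + 1))) *
      (q ^ ((b + 1).choose 2) * ∏ s ∈ range b, ((q ^ L)⁻¹ - (q ^ s)⁻¹)) := by
  induction b with
  | zero => simp [elemSpec_natCast]
  | succ b ih =>
    have h := elemSpec_rec hq0 hq ((L : ℤ) - b)
    have h1 : ((L : ℤ) - (b + 1 : ℕ)) = (L : ℤ) - b - 1 := by push_cast; ring
    have h2 : elemSpec q ((L : ℤ) - b - 1) =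
        q ^ (b + 1) * ((q ^ L)⁻¹ - (q ^ b)⁻¹) * elemSpec q ((L : ℤ) - b) := by
      rw [zpow_sub_one₀ hq0, zpow_sub₀ hq0, zpow_natCast, zpow_natCast] at h
      have hL : q ^ L ≠ 0 := pow_ne_zero _ hq0
      have hb : q ^ b ≠ 0 := pow_ne_zero _ hq0
      rw [pow_succ]
      field_simp at h ⊢
      linear_combination -h
    rw [h1, h2, ih, prod_range_succ, Nat.choose_succ_succ' (b + 1) 1, Nat.choose_one_right,
      pow_add q (b + 1)]
    ring

theorem choose_two_add (m b : ℕ) :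
    (m + b).choose 2 + (b + 1).choose 2 = m.choose 2 + b * (m + b) := by
  induction b with
  | zero => simp
  | succ b ih =>
    rw [← add_assoc, Nat.choose_succ_succ' (m + b) 1, Nat.choose_succ_succ' (b + 1) 1,
      Nat.choose_one_right, Nat.choose_one_right]
    simp only [Nat.reduceAdd]
    linarith

theorem jtDet_zero_zero {K : Type*} [Field K] {q : K} (hq0 : q ≠ 0)
    (hq : ∀ k : ℕ, 1 - q ^ (k + 1) ≠ 0) {N : ℕ} (μ : Fin N → ℕ) (hμ : Antitone μ) :
    jtDet q μ 0 0 = ∏ b : Fin N, (q ^ ((μ b.rev).choose 2) /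
      (∏ i ∈ range (μ b.rev + b), (1 - q ^ (i + 1))) *
        ∏ a ∈ Iio b, (1 - q ^ ((μ b.rev + b) - (μ a.rev + a)))) := by
  set L : Fin N → ℕ := fun a => μ a.rev + a with hL
  have hLmono : ∀ a b : Fin N, a < b → L a < L b := by
    intro a b hab
    have h1 := hμ (Fin.rev_le_rev.2 hab.le)
    have h2 : (a : ℕ) < b := hab
    simp only [hL]
    omega
  set p : Fin N → K[X] := fun b => ∏ s ∈ range b, (X - C (q ^ s)⁻¹) with hp
  have hV := Matrix.det_eval_matrixOfPolynomials_eq_det_vandermonde (fun a => (q ^ L a)⁻¹) p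
    (fun b => by simp only [hp]; rw [natDegree_prod_of_monic _ _ fun s _ => monic_X_sub_C _]; simp)
    (fun b => monic_prod_of_monic _ _ fun s _ => monic_X_sub_C _)
  rw [Matrix.det_vandermonde] at hV
  have hM : (Matrix.of fun i j : Fin N =>
    (if (j : ℕ) < 0 then q ^ ((μ i - i : ℤ) - ((0 : Fin N → ℕ) j - j)) else 1) *
      elemSpec q ((μ i - i : ℤ) - ((0 : Fin N → ℕ) j - j))).submatrix Fin.revPerm Fin.revPerm =
      Matrix.of fun a b : Fin N => (q ^ ((L a).choose 2) /
        (∏ i ∈ range (L a), (1 - q ^ (i + 1)))) * (Matrix.of fun a b : Fin N =>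
          q ^ (((b : ℕ) + 1).choose 2) * (Matrix.of fun a b : Fin N =>
            (p b).eval ((q ^ L a)⁻¹)) a b) a b := by
    ext a b
    have : ((μ a.rev : ℤ) - (a.rev : ℕ) - ((0 : ℕ) - (b.rev : ℕ))) = (L a : ℤ) - (b : ℕ) := by
      simp only [hL, Fin.val_rev]
      omega
    simp only [Matrix.submatrix_apply, Matrix.of_apply, Fin.revPerm_apply, Pi.zero_apply,
      Nat.not_lt_zero, if_false, one_mul, this, elemSpec_sub hq0 hq, hp, eval_prod, eval_sub,
      eval_X, eval_C]
  rw [jtDet, ← Matrix.det_submatrix_equiv_self Fin.revPerm, hM, Matrix.det_mul_column,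
    Matrix.det_mul_row, ← hV, prod_comm' (t' := univ) (s' := fun b => Iio b) (by simp),
    ← prod_mul_distrib, ← prod_mul_distrib]
  refine prod_congr rfl fun b _ => ?_
  have h1 : ∏ a ∈ Iio b, ((q ^ L b)⁻¹ - (q ^ L a)⁻¹) =
      (q ^ (b * L b : ℕ))⁻¹ * ∏ a ∈ Iio b, (1 - q ^ (L b - L a)) := by
    have : ∀ a ∈ Iio b, (q ^ L b)⁻¹ - (q ^ L a)⁻¹ = (q ^ L b)⁻¹ * (1 - q ^ (L b - L a)) := by
      intro a ha
      have h := (hLmono a b (mem_Iio.1 ha)).le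
      rw [mul_sub, mul_one, ← Nat.sub_add_cancel h, Nat.add_sub_cancel, pow_add]
      have := pow_ne_zero (L b - L a) hq0
      have := pow_ne_zero (L a) hq0
      field_simp
    rw [prod_congr rfl this, prod_mul_distrib, prod_const, Fin.card_Iio, mul_comm (b : ℕ),
      pow_mul, inv_pow]
  have h2 : q ^ ((L b).choose 2) * q ^ (((b : ℕ) + 1).choose 2) =
      q ^ ((μ b.rev).choose 2) * q ^ (b * L b : ℕ) := by
    rw [← pow_add, ← pow_add, choose_two_add]
  have h3 := pow_ne_zero (b * L b : ℕ) hq0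
  change _ = q ^ ((μ b.rev).choose 2) / (∏ i ∈ range (L b), (1 - q ^ (i + 1))) *
    ∏ a ∈ Iio b, (1 - q ^ (L b - L a))
  rw [h1]
  calc _ = (q ^ ((L b).choose 2) * q ^ (((b : ℕ) + 1).choose 2)) * (q ^ (b * L b : ℕ))⁻¹ /
        (∏ i ∈ range (L b), (1 - q ^ (i + 1))) * ∏ a ∈ Iio b, (1 - q ^ (L b - L a)) := by ring
    _ = _ := by rw [h2, mul_inv_cancel_right₀ h3]

theorem lt_conjPart_iff {N : ℕ} {μ : ℕ → ℕ} (hμ : Antitone μ) {k : ℕ} (hk : k < N) (j : ℕ) :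
    k < conjPart N μ j ↔ j < μ k := by
  unfold conjPart
  constructor
  · intro h
    by_contra hj
    have : (range N).filter (fun i => j < μ i) ⊆ range k := by
      intro i hi
      rw [mem_filter] at hi
      rw [mem_range]
      by_contra hik
      have := hμ (not_lt.1 hik)
      omega
    have := card_le_card this
    rw [card_range] at this
    omega
  · intro h
    have : range (k + 1) ⊆ (range N).filter (fun i => j < μ i) := by
      intro i hi
      rw [mem_range] at hi
      have := hμ (show i ≤ k by omega)
      rw [mem_filter, mem_range]
      omega
    have := card_le_card this
    rw [card_range] at this
    omega

theorem prod_hook_mul {R : Type*} [CommMonoid R] (f : ℕ → R) {N : ℕ} {μ : ℕ → ℕ}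
    (hμ : Antitone μ) {i : ℕ} (hi : i < N) :
    (∏ j ∈ range (μ i), f (hook N μ i j)) * ∏ k ∈ Ico (i + 1) N, f ((μ i + k) - (μ k + i)) =
      ∏ t ∈ range (μ i + (N - 1 - i)), f (t + 1) := by
  have hle : ∀ j, conjPart N μ j ≤ N := fun j => by
    simpa [conjPart] using card_filter_le (range N) fun i => j < μ i
  have hgt : ∀ j < μ i, i < conjPart N μ j := fun j hj => (lt_conjPart_iff hμ hi j).2 hj
  have hanti : ∀ j j', j ≤ j' → conjPart N μ j' ≤ conjPart N μ j := fun j j' h =>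
    card_le_card fun x hx => by
      rw [mem_filter] at hx ⊢
      exact ⟨hx.1, by omega⟩
  have hinj1 : Set.InjOn (fun j => hook N μ i j) (range (μ i)) := by
    intro j hj j' hj' h
    simp only [coe_range, Set.mem_Iio] at hj hj'
    have h1 := hgt j hj
    have h2 := hgt j' hj'
    simp only [hook] at h
    rcases le_total j j' with h3 | h3
    · have := hanti _ _ h3
      omega
    · have := hanti _ _ h3
      omega
  have hinj2 : Set.InjOn (fun k => (μ i + k) - (μ k + i)) (Ico (i + 1) N) := by
    intro k hk k' hk' h
    simp only [coe_Ico, Set.mem_Ico] at hk hk'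
    have h1 := hμ (show i ≤ k by omega)
    have h2 := hμ (show i ≤ k' by omega)
    simp only at h
    rcases le_total k k' with h3 | h3
    · have := hμ h3
      omega
    · have := hμ h3
      omega
  have hdisj : Disjoint ((range (μ i)).image fun j => hook N μ i j)
      ((Ico (i + 1) N).image fun k => (μ i + k) - (μ k + i)) := by
    rw [disjoint_left]
    intro x hx hx'
    simp only [mem_image, mem_range, mem_Ico] at hx hx'
    obtain ⟨j, hj, rfl⟩ := hx
    obtain ⟨k, hk, h⟩ := hx'
    have h1 := hgt j hj
    have h2 := hμ (show i ≤ k by omega)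
    have h3 := lt_conjPart_iff hμ hk.2 j
    simp only [hook] at h
    by_cases h4 : j < μ k
    · have := h3.2 h4
      omega
    · have := mt h3.1 h4
      omega
  have hunion : ((range (μ i)).image fun j => hook N μ i j) ∪
      ((Ico (i + 1) N).image fun k => (μ i + k) - (μ k + i)) =
      (range (μ i + (N - 1 - i))).image (fun t => t + 1) := by
    refine eq_of_subset_of_card_le ?_ ?_
    · intro x hx
      simp only [mem_union, mem_image, mem_range, mem_Ico] at hx ⊢
      rcases hx with ⟨j, hj, rfl⟩ | ⟨k, hk, rfl⟩
      · have h1 := hgt j hj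
        have h2 := hle j
        exact ⟨hook N μ i j - 1, by unfold hook; omega, by unfold hook; omega⟩
      · have h2 := hμ (show i ≤ k by omega)
        exact ⟨(μ i + k) - (μ k + i) - 1, by omega, by omega⟩
    · rw [card_union_of_disjoint hdisj, card_image_of_injOn hinj1, card_image_of_injOn hinj2,
        card_image_of_injective _ (add_left_injective 1)]
      simp only [card_range, Nat.card_Ico]
      omega
  rw [← prod_image (g := fun j => hook N μ i j) hinj1,
    ← prod_image (g := fun k => (μ i + k) - (μ k + i)) hinj2, ← prod_union hdisj, hunion,
    prod_image ((add_left_injective 1).injOn)]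

theorem jtDet_mul_prod_hook {K : Type*} [Field K] {q : K} (hq0 : q ≠ 0)
    (hq : ∀ k : ℕ, 1 - q ^ (k + 1) ≠ 0) (N : ℕ) (μ : ℕ → ℕ) (hμ : Antitone μ) :
    jtDet q (fun i : Fin N => μ i) 0 0 *
        ∏ i ∈ range N, ∏ j ∈ range (μ i), (1 - q ^ hook N μ i j) =
      q ^ ∑ i ∈ range N, (μ i).choose 2 := by
  rw [jtDet_zero_zero hq0 hq _ (fun a b hab => hμ hab), ← Fin.prod_univ_eq_prod_range
    (fun i => ∏ j ∈ range (μ i), (1 - q ^ hook N μ i j)), ← Equiv.prod_comp Fin.revPerm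
    (fun i : Fin N => ∏ j ∈ range (μ i), (1 - q ^ hook N μ i j)),
    ← prod_mul_distrib, ← prod_pow_eq_pow_sum, ← Fin.prod_univ_eq_prod_range
    (fun i => q ^ (μ i).choose 2), ← Equiv.prod_comp Fin.revPerm (fun i : Fin N => q ^ _)]
  refine prod_congr rfl fun b _ => ?_
  have h := prod_hook_mul (fun k => 1 - q ^ k) hμ b.rev.isLt
  have h1 : N - 1 - (b.rev : ℕ) = b := by
    rw [Fin.val_rev]
    omega
  have h2 : ∏ k ∈ Ico ((b.rev : ℕ) + 1) N, (1 - q ^ ((μ b.rev + k) - (μ k + b.rev))) =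
      ∏ a ∈ Iio b, (1 - q ^ ((μ b.rev + b) - (μ a.rev + a))) := by
    symm
    refine prod_nbij (fun a => (a.rev : ℕ)) ?_ ?_ ?_ ?_
    · intro a ha
      have : (a : ℕ) < b := Fin.lt_def.1 (mem_Iio.1 ha)
      simp only [Fin.val_rev, mem_Ico]
      omega
    · intro a _ a' _ h
      exact Fin.rev_injective (Fin.ext h)
    · intro k hk
      simp only [Fin.val_rev, coe_Ico, Set.mem_Ico] at hk
      refine ⟨⟨N - 1 - k, by omega⟩, ?_, ?_⟩
      · rw [coe_Iio, Set.mem_Iio, Fin.lt_def]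
        dsimp only
        omega
      · simp only [Fin.val_rev]
        omega
    · intro a ha
      have : (a : ℕ) < b := Fin.lt_def.1 (mem_Iio.1 ha)
      congr 2
      simp only [Fin.val_rev]
      omega
  rw [h1, h2] at h
  have h3 : ∏ i ∈ range (μ b.rev + b), (1 - q ^ (i + 1)) ≠ 0 := prod_ne_zero_iff.2 fun i _ => hq i
  simp only [Fin.revPerm_apply]
  rw [mul_assoc, mul_comm (∏ a ∈ Iio b, _), h, div_mul_cancel₀ _ h3]

/-- The number of occurrences of the letter `i` among the first `n` letters of the word `w`. -/
def prefixCount {N M : ℕ} (w : Fin M → Fin N) (n : ℕ) (i : Fin N) : ℕ :=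
  #{l : Fin M | (l : ℕ) < n ∧ w l = i}

/-- The word `w` describes a growth from `ν` to `μ` through partitions: its letters are the rows of
the boxes added successively. -/
def IsGrowth {N M : ℕ} (μ ν : Fin N → ℕ) (w : Fin M → Fin N) : Prop :=
  (∀ n, Antitone fun i => ν i + prefixCount w n i) ∧ ∀ i, ν i + prefixCount w M i = μ i

/-- The charge of a word of rows, when the previous letter is `r - 1`. -/
def wordCharge {N : ℕ} : (M : ℕ) → ℕ → (Fin M → Fin N) → ℕ
  | 0, _, _ => 0
  | M + 1, r, w => (if (w 0 : ℕ) < r then M + 1 else 0) + wordCharge M (w 0 + 1) (Fin.tail w)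

theorem prefixCount_zero {N M : ℕ} (w : Fin M → Fin N) (i : Fin N) : prefixCount w 0 i = 0 := by
  simp [prefixCount]

theorem add_prefixCount_cons {N M : ℕ} (ν : Fin N → ℕ) (s : Fin N) (w : Fin M → Fin N) (n : ℕ)
    (i : Fin N) : ν i + prefixCount (Fin.cons s w : Fin (M + 1) → Fin N) (n + 1) i =
      Function.update ν s (ν s + 1) i + prefixCount w n i := by
  simp only [prefixCount, card_filter, Fin.sum_univ_succ, Fin.cons_zero, Fin.cons_succ,
    Fin.val_zero, Fin.val_succ, Nat.succ_pos, true_and, Nat.add_lt_add_iff_right]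
  rcases eq_or_ne s i with rfl | h
  · simp [add_assoc]
  · simp [h, Function.update_of_ne h.symm]

theorem isGrowth_cons {N M : ℕ} (μ ν : Fin N → ℕ) (hν : Antitone ν) (s : Fin N)
    (w : Fin M → Fin N) : IsGrowth μ ν (Fin.cons s w : Fin (M + 1) → Fin N) ↔
      IsGrowth μ (Function.update ν s (ν s + 1)) w := by
  unfold IsGrowth
  simp only [add_prefixCount_cons]
  refine and_congr_left fun _ => ⟨fun h n => ?_, fun h n => ?_⟩
  · simpa only [add_prefixCount_cons] using h (n + 1)
  · cases n with
    | zero => simpa only [prefixCount_zero, add_zero] using hν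
    | succ n => simpa only [add_prefixCount_cons] using h n

theorem IsGrowth.antitone {N M : ℕ} {μ ν : Fin N → ℕ} {w : Fin M → Fin N}
    (h : IsGrowth μ ν w) : Antitone ν := by
  simpa only [prefixCount_zero, add_zero] using h.1 0

theorem growthGF_mul {K : Type*} [Field K] {q : K} (hq : ∀ k : ℕ, 1 - q ^ (k + 1) ≠ 0) {N : ℕ}
    (μ : Fin N → ℕ) (M : ℕ) : ∀ (ν : Fin N → ℕ), Antitone ν → ∀ r,
      growthGF q μ M ν r * ∏ k ∈ range M, (1 - q ^ (k + 1)) =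
        ∑ w : Fin M → Fin N, if IsGrowth μ ν w then q ^ wordCharge M r w else 0 := by
  induction M with
  | zero =>
    intro ν hν r
    have : IsGrowth μ ν (default : Fin 0 → Fin N) ↔ ν = μ := by
      simp only [IsGrowth, prefixCount, univ_eq_empty, filter_empty, card_empty, add_zero]
      exact ⟨fun h => funext h.2, fun h => ⟨fun _ => hν, fun i => congrFun h i⟩⟩
    rw [Fintype.sum_unique, growthGF, if_congr this rfl rfl]
    simp [wordCharge]
  | succ M ih =>
    intro ν hν r
    rw [← (Fin.consEquiv fun _ => Fin N).sum_comp, Fintype.sum_prod_type, growthGF, sum_mul]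
    refine sum_congr rfl fun s _ => ?_
    simp only [Fin.consEquiv, Equiv.coe_fn_mk, isGrowth_cons μ ν hν, wordCharge, Fin.cons_zero,
      Fin.tail_cons]
    split_ifs with h hr
    · rw [← sum_congr rfl fun w _ => (mul_ite_zero _ _ _).trans (by rw [← pow_add]), ← mul_sum,
        ← ih _ h, prod_range_succ]
      have := hq M
      field_simp
    · simp only [zero_add]
      rw [← ih _ h, prod_range_succ]
      have := hq M
      field_simp
    · rw [zero_mul, sum_eq_zero]
      intro w _
      rw [if_neg fun hw => h hw.antitone]
    · rw [zero_mul, sum_eq_zero]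
      intro w _
      rw [if_neg fun hw => h hw.antitone]

theorem chargeAux_succ (p : ℕ → ℕ) (r : ℕ) :
    chargeAux p (r + 1) = (if p 0 < p 1 then 1 else 0) + chargeAux (fun k => p (k + 1)) r := by
  induction r with
  | zero => simp [chargeAux]
  | succ r ih => rw [chargeAux, ih, chargeAux, add_assoc]

theorem sum_chargeAux_eq {N : ℕ} (M : ℕ) : ∀ (r : ℕ) (p : ℕ → ℕ) (w : Fin (M + 1) → Fin N),
    (∀ k (hk : k + 1 < M + 1), p k < p (k + 1) ↔ w ⟨k + 1, hk⟩ ≤ w ⟨k, by omega⟩) →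
    (if (w 0 : ℕ) < r then M + 1 else 0) + ∑ k ∈ range (M + 1), chargeAux p k =
      wordCharge (M + 1) r w := by
  induction M with
  | zero =>
    intro r p w _
    simp [wordCharge, chargeAux]
  | succ M ih =>
    intro r p w h
    rw [wordCharge, ← ih _ (fun k => p (k + 1)) (Fin.tail w) fun k hk => h (k + 1) (by omega),
      sum_range_succ']
    simp only [chargeAux_succ, sum_add_distrib, sum_const, card_range, smul_eq_mul]
    have h0 : p 0 < p 1 ↔ (Fin.tail w 0 : ℕ) < w 0 + 1 := by
      rw [Nat.lt_succ_iff]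
      exact h 0 (by omega)
    simp only [h0, chargeAux]
    split_ifs <;> ring

theorem IsSYT.readPos_lt_iff {N : ℕ} {μ : ℕ → ℕ} {T : Fin N → Fin N × Fin N} (hT : IsSYT N μ T)
    {k l : Fin N} (hkl : k < l) :
    readPos N μ (T k) < readPos N μ (T l) ↔ (T l).1 ≤ (T k).1 := by
  have hlt : ∀ a b : Fin N, (T a).1 < (T b).1 → readPos N μ (T b) < readPos N μ (T a) := by
    intro a b hab
    have h1 := hT.1 b
    have h2 : ((T a).1 : ℕ) < (T b).1 := hab
    have h3 : ∑ i ∈ Ico ((T b).1 : ℕ) N, μ i ≤ ∑ i ∈ Ico ((T a).1 + 1 : ℕ) N, μ i :=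
      sum_le_sum_of_subset (Ico_subset_Ico_left (by omega))
    rw [sum_eq_sum_Ico_succ_bot (T b).1.isLt] at h3
    simp only [readPos]
    omega
  rcases lt_trichotomy (T k).1 (T l).1 with h | h | h
  · exact iff_of_false (hlt _ _ h).not_gt h.not_ge
  · refine iff_of_true ?_ h.ge
    have : (T k).2 < (T l).2 := by
      by_contra hle
      exact (hT.2.2.2 l k h.ge (not_lt.1 hle) fun he => hkl.ne' (hT.2.1 he)).not_gt hkl
    simp only [readPos, h]
    have : ((T k).2 : ℕ) < (T l).2 := this
    omega
  · exact iff_of_true (hlt _ _ h) h.le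

theorem IsSYT.charge_eq {N : ℕ} {μ : ℕ → ℕ} {T : Fin N → Fin N × Fin N} (hT : IsSYT N μ T) :
    charge N μ T = wordCharge N 0 fun k => (T k).1 := by
  cases N with
  | zero => simp [charge, wordCharge]
  | succ N =>
    rw [← sum_chargeAux_eq N 0
      (fun k => if h : k < N + 1 then readPos (N + 1) μ (T ⟨k, h⟩) else 0)]
    · simp [charge]
    · intro k hk
      rw [dif_pos hk, dif_pos (by omega : k < N + 1)]
      exact hT.readPos_lt_iff (Fin.mk_lt_mk.2 (Nat.lt_succ_self k))

theorem IsSYT.col_eq {N : ℕ} {μ : ℕ → ℕ} {T : Fin N → Fin N × Fin N} (hT : IsSYT N μ T)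
    (k : Fin N) : ((T k).2 : ℕ) = prefixCount (fun l => (T l).1) k (T k).1 := by
  rw [prefixCount, ← card_range ((T k).2 : ℕ)]
  symm
  refine card_nbij (fun l => ((T l).2 : ℕ)) ?_ ?_ ?_
  · intro l hl
    simp only [coe_filter, mem_univ, true_and, Set.mem_ofPred_eq] at hl
    simp only [coe_range, Set.mem_Iio]
    by_contra hle
    have hkl : k ≠ l := fun h => by simp [h] at hl
    have := hT.2.2.2 k l hl.2.ge (not_lt.1 hle) fun he => hkl (hT.2.1 he)
    exact absurd hl.1 (not_lt.2 this.le)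
  · intro l hl l' hl' h
    simp only [coe_filter, mem_univ, true_and, Set.mem_ofPred_eq] at hl hl'
    exact hT.2.1 (Prod.ext (hl.2.trans hl'.2.symm) (Fin.ext h))
  · intro j hj
    simp only [coe_range, Set.mem_Iio] at hj
    have hjN : j < N := hj.trans (T k).2.isLt
    obtain ⟨l, hl⟩ := hT.2.2.1 (T k).1 ⟨j, hjN⟩ (hj.trans (hT.1 k))
    refine ⟨l, ?_, by simp [hl]⟩
    simp only [coe_filter, mem_univ, true_and, Set.mem_ofPred_eq, hl, and_true]
    refine hT.2.2.2 l k (by rw [hl]) (by rw [hl]; exact hj.le) fun he => ?_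
    rw [hl] at he
    exact absurd (congrArg (fun c => (c.2 : ℕ)) he) hj.ne

theorem IsSYT.isGrowth {N : ℕ} {μ : ℕ → ℕ} (hμ : Antitone μ) (hle : ∀ i, μ i ≤ N)
    {T : Fin N → Fin N × Fin N} (hT : IsSYT N μ T) :
    IsGrowth (fun i : Fin N => μ i) 0 fun k => (T k).1 := by
  refine ⟨fun n i i' hi => ?_, fun i => ?_⟩
  · simp only [Pi.zero_apply, zero_add, prefixCount]
    have hex : ∀ l : Fin N, ∃ l' : Fin N, (T l).1 = i' → T l' = (i, (T l).2) := by
      intro l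
      by_cases hl : (T l).1 = i'
      · obtain ⟨l', hl'⟩ := hT.2.2.1 i (T l).2 ((hT.1 l).trans_le (by rw [hl]; exact hμ hi))
        exact ⟨l', fun _ => hl'⟩
      · exact ⟨l, fun h => absurd h hl⟩
    choose g hg using hex
    refine card_le_card_of_injOn g ?_ ?_
    · intro l hl
      simp only [coe_filter, mem_univ, true_and, Set.mem_ofPred_eq] at hl ⊢
      have h := hg l hl.2
      refine ⟨?_, by rw [h]⟩
      by_cases he : g l = l
      · rw [he]; exact hl.1
      · have := hT.2.2.2 (g l) l (by rw [h, hl.2]; exact hi) (by rw [h]) fun h => he (hT.2.1 h)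
        exact lt_trans this hl.1
    · intro l hl l' hl' h
      simp only [coe_filter, mem_univ, true_and, Set.mem_ofPred_eq] at hl hl'
      have h1 := hg l hl.2
      have h2 := hg l' hl'.2
      rw [h, h2] at h1
      exact hT.2.1 (Prod.ext (hl.2.trans hl'.2.symm) (congrArg Prod.snd h1).symm)
  · simp only [Pi.zero_apply, zero_add, prefixCount]
    rw [← card_range (μ i)]
    refine card_nbij (fun l => ((T l).2 : ℕ)) ?_ ?_ ?_
    · intro l hl
      simp only [coe_filter, mem_univ, true_and, Set.mem_ofPred_eq] at hl
      simp only [coe_range, Set.mem_Iio, ← hl.2]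
      exact hT.1 l
    · intro l hl l' hl' h
      simp only [coe_filter, mem_univ, true_and, Set.mem_ofPred_eq] at hl hl'
      exact hT.2.1 (Prod.ext (hl.2.trans hl'.2.symm) (Fin.ext h))
    · intro j hj
      simp only [coe_range, Set.mem_Iio] at hj
      obtain ⟨l, hl⟩ := hT.2.2.1 i ⟨j, hj.trans_le (hle i)⟩ hj
      exact ⟨l, by simp [hl], by simp [hl]⟩

theorem prefixCount_mono {N M : ℕ} (w : Fin M → Fin N) (i : Fin N) {n n' : ℕ} (h : n ≤ n') :
    prefixCount w n i ≤ prefixCount w n' i :=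
  card_le_card fun l hl => by
    simp only [mem_filter, mem_univ, true_and] at hl ⊢
    exact ⟨hl.1.trans_le h, hl.2⟩

theorem prefixCount_succ {N M : ℕ} (w : Fin M → Fin N) (l : Fin M) (i : Fin N) :
    prefixCount w (l + 1) i = prefixCount w l i + if w l = i then 1 else 0 := by
  have h : ∀ x : Fin M, (if (x : ℕ) < l + 1 ∧ w x = i then 1 else 0) =
      (if (x : ℕ) < l ∧ w x = i then 1 else 0) + if x = l then (if w l = i then 1 else 0) else 0 := by
    intro x
    rcases eq_or_ne x l with rfl | hx
    · simp
    · have : (x : ℕ) ≠ l := fun h => hx (Fin.ext h)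
      have h2 : ((x : ℕ) < l + 1 ↔ (x : ℕ) < l) := by omega
      simp only [h2, if_neg hx, add_zero]
  simp only [prefixCount, card_filter, h, sum_add_distrib, sum_ite_eq', mem_univ, if_true]

theorem prefixCount_lt {N M : ℕ} (w : Fin M → Fin N) (l : Fin M) {n : ℕ} (h : (l : ℕ) < n) :
    prefixCount w l (w l) < prefixCount w n (w l) := by
  have h1 := prefixCount_mono w (w l) (Nat.succ_le_of_lt h)
  rw [Nat.succ_eq_add_one, prefixCount_succ, if_pos rfl] at h1
  exact h1

theorem prefixCount_le {N M : ℕ} (w : Fin M → Fin N) (n : ℕ) (i : Fin N) :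
    prefixCount w n i ≤ M := by
  simpa [prefixCount] using card_filter_le (univ : Finset (Fin M)) fun l => (l : ℕ) < n ∧ w l = i

/-- The tableau whose `k`-th entry lies in row `w k`, at the end of that row. -/
def wordTableau {N : ℕ} (w : Fin N → Fin N) (k : Fin N) : Fin N × Fin N :=
  (w k, ⟨prefixCount w k (w k), (prefixCount_lt w k k.isLt).trans_le (prefixCount_le w N (w k))⟩)

theorem IsGrowth.isSYT_wordTableau {N : ℕ} {μ : ℕ → ℕ} (hsum : ∑ i ∈ range N, μ i = N)
    {w : Fin N → Fin N} (hw : IsGrowth (fun i : Fin N => μ i) 0 w) :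
    IsSYT N μ (wordTableau w) := by
  have hend : ∀ i : Fin N, prefixCount w N i = μ i := fun i => by simpa using hw.2 i
  have hanti : ∀ n, Antitone (prefixCount w n) := fun n => by simpa using hw.1 n
  have hmem : ∀ k, ((wordTableau w k).2 : ℕ) < μ (wordTableau w k).1 := fun k => by
    rw [← hend]
    exact prefixCount_lt w k k.isLt
  have hinj : Function.Injective (wordTableau w) := by
    have : ∀ k l, k < l → wordTableau w k ≠ wordTableau w l := by
      intro k l hkl h
      have h1 : w k = w l := congrArg Prod.fst h
      have h2 : prefixCount w k (w k) = prefixCount w l (w l) :=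
        congrArg (fun c : Fin N × Fin N => (c.2 : ℕ)) h
      rw [← h1] at h2
      exact (prefixCount_lt w k hkl).ne h2
    intro k l h
    rcases lt_trichotomy k l with hkl | hkl | hkl
    · exact absurd h (this _ _ hkl)
    · exact hkl
    · exact absurd h.symm (this _ _ hkl)
  refine ⟨hmem, hinj, fun i j hij => ?_, fun k l h1 h2 hne => ?_⟩
  · have hcard : #{c : Fin N × Fin N | (c.2 : ℕ) < μ c.1} ≤ N := by
      rw [card_filter, Fintype.sum_prod_type]
      calc _ ≤ ∑ i : Fin N, μ i := by
            refine sum_le_sum fun i _ => ?_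
            rw [← card_filter]
            calc _ ≤ #(range (μ i)) := card_le_card_of_injOn (fun j : Fin N => (j : ℕ))
                    (by intro j; simp) (fun a _ b _ h => Fin.ext h)
              _ = μ i := card_range _
        _ = N := by rw [Fin.sum_univ_eq_sum_range μ, hsum]
    have himg : univ.image (wordTableau w) =
        univ.filter fun c : Fin N × Fin N => (c.2 : ℕ) < μ c.1 := by
      refine eq_of_subset_of_card_le ?_ ?_
      · intro c hc
        obtain ⟨k, -, rfl⟩ := mem_image.1 hc
        simpa using hmem k
      · rw [card_image_of_injective _ hinj, card_univ, Fintype.card_fin]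
        exact hcard
    have : (i, j) ∈ univ.image (wordTableau w) := by
      rw [himg]
      simpa using hij
    obtain ⟨k, -, hk⟩ := mem_image.1 this
    exact ⟨k, hk⟩
  · by_contra hkl
    have hlk : l < k := lt_of_le_of_ne (not_lt.1 hkl) fun h => hne (by rw [h])
    change w k ≤ w l at h1
    change prefixCount w k (w k) ≤ prefixCount w l (w l) at h2
    have h3 := prefixCount_lt w l (Nat.lt_succ_self l)
    have h4 := hanti (l + 1) h1
    have h5 := prefixCount_mono w (w k) (Nat.succ_le_of_lt hlk)
    simp only [Nat.succ_eq_add_one] at h3 h4 h5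
    omega

theorem kostkaColumn_eq {N : ℕ} {μ : ℕ → ℕ} (hμ : Antitone μ)
    (hsum : ∑ i ∈ range N, μ i = N) (hle : ∀ i, μ i ≤ N) :
    kostkaColumn N μ = ∑ w : Fin N → Fin N,
      if IsGrowth (fun i : Fin N => μ i) 0 w then X ^ wordCharge N 0 w else 0 := by
  rw [kostkaColumn, ← sum_filter]
  refine sum_nbij (fun T k => (T k).1) ?_ ?_ ?_ ?_
  · intro T hT
    simp only [mem_filter, mem_univ, true_and] at hT ⊢
    exact hT.isGrowth hμ hle
  · intro T hT T' hT' h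
    simp only [coe_filter, mem_univ, true_and, Set.mem_ofPred_eq] at hT hT'
    have hrow : (fun k => (T k).1) = fun k => (T' k).1 := h
    funext k
    refine Prod.ext (congrFun hrow k) (Fin.ext ?_)
    rw [hT.col_eq, hT'.col_eq, hrow, congrFun hrow k]
  · intro w hw
    simp only [coe_filter, mem_univ, true_and, Set.mem_ofPred_eq] at hw
    exact ⟨wordTableau w, by simpa using hw.isSYT_wordTableau hsum, rfl⟩
  · intro T hT
    simp only [mem_filter, mem_univ, true_and] at hT
    rw [hT.charge_eq]

/-- The hook length formula for the Kostka polynomial at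
column content: `K_{μ,(1^N)}(q) = q^{n(μ')} (q)_N / ∏_{x∈μ}(1 - q^{h(x)})`,
with `n(μ') = Σ_i C(μ_i,2)` and `(q)_N = ∏_{i=1}^N (1-q^i)`, stated with
denominators cleared as a polynomial identity. -/
theorem kostka_hook_length_formula (N : ℕ) (μ : ℕ → ℕ) (hμ : Antitone μ)
    (hsum : ∑ i ∈ Finset.range N, μ i = N) (hzero : ∀ i, N ≤ i → μ i = 0) :
    kostkaColumn N μ *
        ∏ i ∈ Finset.range N, ∏ j ∈ Finset.range (μ i),
          (1 - Polynomial.X ^ hook N μ i j) =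
      Polynomial.X ^ (∑ i ∈ Finset.range N, Nat.choose (μ i) 2) *
        ∏ k ∈ Finset.range N, (1 - Polynomial.X ^ (k + 1)) := by
  have hle : ∀ i, μ i ≤ N := fun i => by
    rcases lt_or_ge i N with h | h
    · exact (single_le_sum (fun _ _ => Nat.zero_le _) (mem_range.2 h)).trans hsum.le
    · rw [hzero i h]
      exact Nat.zero_le N
  have hinj : Function.Injective (algebraMap ℤ[X] (FractionRing ℤ[X])) :=
    IsFractionRing.injective _ _
  set q : FractionRing ℤ[X] := algebraMap ℤ[X] _ X with hqdef
  have hq0 : q ≠ 0 := (map_ne_zero_iff _ hinj).2 X_ne_zero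
  have hq : ∀ k : ℕ, 1 - q ^ (k + 1) ≠ 0 := by
    intro k
    rw [hqdef, ← map_pow, ← map_one (algebraMap ℤ[X] (FractionRing ℤ[X])), ← map_sub]
    refine (map_ne_zero_iff _ hinj).2 fun h => ?_
    simpa using congrArg (eval 0) h
  have hν : Antitone (0 : Fin N → ℕ) := fun _ _ _ => le_rfl
  have hgf := growthGF_mul hq (fun i : Fin N => μ i) N 0 hν 0
  rw [← jtDet_eq_growthGF hq0 hq _ (fun a b hab => hμ hab) N 0 hν
    (by simp [Fin.sum_univ_eq_sum_range μ, hsum]) 0 (Nat.zero_le N)] at hgf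
  have hK : algebraMap ℤ[X] (FractionRing ℤ[X]) (kostkaColumn N μ) =
      jtDet q (fun i : Fin N => μ i) 0 0 * ∏ k ∈ range N, (1 - q ^ (k + 1)) := by
    rw [hgf, kostkaColumn_eq hμ hsum hle, map_sum]
    refine sum_congr rfl fun w _ => ?_
    split_ifs <;> simp [hqdef]
  apply hinj
  simp only [map_mul, map_prod, map_sub, map_one, map_pow, hK]
  rw [← hqdef, ← jtDet_mul_prod_hook hq0 hq N μ hμ]
  ring
end

section
/- For the diagonal action of S_N on the tensor product π^{⊗N} ⊗ ℂ[z_1,...,z_N], where π = ℂ^n is the standard n-dimensional representation (S_N permutes tensor factors and polynomial variables simultaneously), the subspace of S_N-invariants (π^{⊗N} ⊗ ℂ[z_1,...,z_N])^{S_N} is a free module of rank n^N over the ring of symmetric polynomials ℂ[z_1,...,z_N]^{S_N}. -/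
open MvPolynomial Finset

/-- The model for `π^{⊗N} ⊗ ℂ[z_1,…,z_N]` with `π = ℂ^n`: functions on words
`w : Fin N → Fin n` (the standard tensor basis of `π^{⊗N}`) with values in
`ℂ[z_1,…,z_N]`. -/
abbrev VN (N n : ℕ) : Type := (Fin N → Fin n) → MvPolynomial (Fin N) ℂ

/-- The diagonal action of `σ ∈ S_N`, permuting tensor factors and polynomial
variables simultaneously. -/
noncomputable def diagAct {N n : ℕ} (σ : Equiv.Perm (Fin N)) (F : VN N n) : VN N n :=
  fun w => MvPolynomial.rename (⇑σ) (F (w ∘ ⇑σ))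

/-- The cyclic vector `w₀ = v₀ ⊗ ⋯ ⊗ v₀ ⊗ 1`. -/
noncomputable def w0 (N n : ℕ) [NeZero n] : VN N n :=
  fun w => if w = (fun _ => (0 : Fin n)) then 1 else 0

/-- The action of the current algebra element `x ⊗ t^k` on the tensor product of
formal evaluation modules: `x` acts in the `i`-th tensor factor together with
multiplication by `z_i^k`, summed over `i`. -/
noncomputable def currentOp {N n : ℕ} (x : Matrix (Fin n) (Fin n) ℂ) (k : ℕ)
    (F : VN N n) : VN N n :=
  fun v => ∑ i : Fin N, MvPolynomial.X i ^ k *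
    ∑ a : Fin n, MvPolynomial.C (x (v i) a) * F (Function.update v i a)

/-- The key of the basis vector `v ⊗ z^e`: exponents are compared lexicographically, and ties are
broken by the reversed lexicographic order on words. -/
def wordKey {N n : ℕ} (e : Fin N →₀ ℕ) (v : Fin N → Fin n) :
    Lex (Fin N →₀ ℕ) ×ₗ (Lex (Fin N → Fin n))ᵒᵈ :=
  toLex (toLex e, OrderDual.toDual (toLex v))

/-- `v ⊗ z^e` is the leading term of `F`. -/
def LeadsAt {N n : ℕ} (F : VN N n) (e : Fin N →₀ ℕ) (v : Fin N → Fin n) : Prop :=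
  coeff e (F v) ≠ 0 ∧ ∀ e' v', coeff e' (F v') ≠ 0 → wordKey e' v' ≤ wordKey e v

/-- `z^l` is the lexicographically leading monomial of `p`. -/
def PolyLeadsAt {N : ℕ} (p : MvPolynomial (Fin N) ℂ) (l : Fin N →₀ ℕ) : Prop :=
  coeff l p ≠ 0 ∧ ∀ m, coeff m p ≠ 0 → toLex m ≤ toLex l

/-- The exponents weakly decrease, and the letters weakly increase where exponents are equal. -/
def IsSortedPair {N n : ℕ} (e : Fin N →₀ ℕ) (v : Fin N → Fin n) : Prop :=
  Monotone fun i => (toLex (OrderDual.toDual (e i), v i) : ℕᵒᵈ ×ₗ Fin n)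

/-- The sum over `S_N` of the images of `v ⊗ z^e`. -/
noncomputable def orbitSum {N n : ℕ} (e : Fin N →₀ ℕ) (v : Fin N → Fin n) : VN N n :=
  fun u => ∑ σ : Equiv.Perm (Fin N), diagAct σ (Pi.single v (monomial e 1)) u

/-- The exponent counting, at position `i`, the descents of `w` at or after `i`. -/
noncomputable def descentExponent {N n : ℕ} (w : Fin N → Fin n) : Fin N →₀ ℕ :=
  Finsupp.equivFunOnFinite.symm fun i =>
    #{j : Fin N | i ≤ j ∧ ∃ h : (j : ℕ) + 1 < N, w ⟨j + 1, h⟩ < w j}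

lemma wordKey_le_iff {N n : ℕ} {e e' : Fin N →₀ ℕ} {v v' : Fin N → Fin n} :
    wordKey e v ≤ wordKey e' v' ↔
      toLex e < toLex e' ∨ e = e' ∧ toLex v' ≤ toLex v := by
  simp [wordKey, Prod.Lex.toLex_le_toLex]

lemma wordKey_injective {N n : ℕ} {e e' : Fin N →₀ ℕ} {v v' : Fin N → Fin n}
    (h : wordKey e v = wordKey e' v') : e = e' ∧ v = v' := by
  simpa [wordKey] using h

lemma diagAct_diagAct {N n : ℕ} (τ σ : Equiv.Perm (Fin N)) (F : VN N n) :
    diagAct τ (diagAct σ F) = diagAct (τ * σ) F := by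
  funext w
  simp only [diagAct, rename_rename]
  rfl

lemma diagAct_orbitSum {N n : ℕ} (e : Fin N →₀ ℕ) (v : Fin N → Fin n)
    (τ : Equiv.Perm (Fin N)) : diagAct τ (orbitSum e v) = orbitSum e v := by
  funext u
  have h : diagAct τ (orbitSum e v) u =
      ∑ σ : Equiv.Perm (Fin N), diagAct τ (diagAct σ (Pi.single v (monomial e 1))) u := by
    simp only [diagAct, orbitSum, map_sum]
  rw [h]
  simp only [diagAct_diagAct]
  exact Equiv.sum_comp (Equiv.mulLeft τ)
    fun σ => diagAct σ (Pi.single v (monomial e (1 : ℂ))) u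

lemma coeff_of_invariant {N n : ℕ} {F : VN N n} {σ : Equiv.Perm (Fin N)}
    (hF : diagAct σ F = F) (e : Fin N →₀ ℕ) (w : Fin N → Fin n) :
    coeff (e.mapDomain σ) (F w) = coeff e (F (w ∘ σ)) := by
  conv_lhs => rw [← hF]
  exact coeff_rename_mapDomain _ σ.injective _ _

lemma coeff_orbitSum {N n : ℕ} (e e' : Fin N →₀ ℕ) (v u : Fin N → Fin n) :
    coeff e' (orbitSum e v u) =
      #{σ : Equiv.Perm (Fin N) | e.mapDomain σ = e' ∧ u ∘ σ = v} := by
  classical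
  rw [Finset.card_filter, orbitSum, coeff_sum]
  push_cast
  refine Finset.sum_congr rfl fun σ _ => ?_
  by_cases h : u ∘ σ = v
  · simp [diagAct, h, rename_monomial, coeff_monomial]
  · simp [diagAct, h]

lemma exists_leadsAt {N n : ℕ} {F : VN N n} (hF : F ≠ 0) : ∃ e v, LeadsAt F e v := by
  classical
  obtain ⟨v, hv⟩ := Function.ne_iff.mp hF
  obtain ⟨e, he⟩ := MvPolynomial.ne_zero_iff.mp hv
  obtain ⟨p, hp, hmax⟩ := Finset.exists_max_image
    (Finset.univ.sigma fun v => (F v).support) (fun p => wordKey p.2 p.1)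
    ⟨⟨v, e⟩, by simpa using he⟩
  refine ⟨p.2, p.1, by simpa using hp, fun e' v' h => hmax ⟨v', e'⟩ (by simpa using h)⟩

lemma exists_polyLeadsAt {N : ℕ} {p : MvPolynomial (Fin N) ℂ} (hp : p ≠ 0) :
    ∃ l, PolyLeadsAt p l := by
  obtain ⟨l, hl, hmax⟩ := Finset.exists_max_image p.support toLex
    (Finset.nonempty_iff_ne_empty.mpr (by simpa using hp))
  exact ⟨l, by simpa using hl, fun m hm => hmax m (by simpa using hm)⟩

/-- The leading term of an invariant vector is sorted. -/
lemma LeadsAt.isSortedPair {N n : ℕ} {F : VN N n} {e : Fin N →₀ ℕ} {v : Fin N → Fin n}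
    (h : LeadsAt F e v) (hF : ∀ σ, diagAct σ F = F) : IsSortedPair e v := by
  refine monotone_iff_forall_lt.mpr fun i j hij => ?_
  by_contra hlt
  rw [not_le, Prod.Lex.toLex_lt_toLex] at hlt
  simp only [OrderDual.toDual_lt_toDual, OrderDual.toDual_inj] at hlt
  set σ := Equiv.swap i j with hσ
  have happ : ∀ k, e.mapDomain σ k = e (σ k) := fun k => by
    conv_lhs => rw [show k = σ (σ k) by simp [hσ]]
    exact Finsupp.mapDomain_apply σ.injective _ _
  have hinv : (v ∘ σ) ∘ σ = v := by
    funext k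
    simp [hσ]
  have hne : coeff (e.mapDomain σ) (F (v ∘ σ)) ≠ 0 := by
    rw [coeff_of_invariant (hF σ), hinv]
    exact h.1
  have hfix : ∀ k < i, σ k = k := fun k hk =>
    Equiv.swap_apply_of_ne_of_ne hk.ne (hk.trans hij).ne
  have hle := h.2 _ _ hne
  rw [wordKey_le_iff] at hle
  rcases hlt with hlt | ⟨heq, hlt⟩
  · have hlex : toLex e < toLex (e.mapDomain σ) := by
      rw [Finsupp.Lex.lt_iff]
      exact ⟨i, fun k hk => by simp [happ, hfix k hk], by simpa [happ, hσ] using hlt⟩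
    rcases hle with hle | ⟨hle, -⟩
    · exact lt_asymm hle hlex
    · rw [hle] at hlex
      exact lt_irrefl _ hlex
  · have hE : e.mapDomain σ = e := by
      ext k
      rw [happ]
      rcases eq_or_ne k i with rfl | hki
      · simpa [hσ] using heq
      rcases eq_or_ne k j with rfl | hkj
      · simpa [hσ] using heq.symm
      rw [hσ, Equiv.swap_apply_of_ne_of_ne hki hkj]
    rw [hE] at hle
    rcases hle with hle | ⟨-, hle⟩
    · exact lt_irrefl _ hle
    · refine not_lt_of_ge hle ?_
      exact ⟨i, fun k hk => by simp [hfix k hk], by simpa [hσ] using hlt⟩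

/-- The orbit sum of a sorted pair has that pair as leading term. -/
lemma leadsAt_orbitSum {N n : ℕ} {e : Fin N →₀ ℕ} {v : Fin N → Fin n}
    (h : IsSortedPair e v) : LeadsAt (orbitSum e v) e v := by
  classical
  have hne : coeff e (orbitSum e v v) ≠ 0 := by
    rw [coeff_orbitSum]
    exact Nat.cast_ne_zero.mpr (Finset.card_ne_zero.mpr
      ⟨1, by simp [Equiv.Perm.coe_one, Finsupp.mapDomain_id]⟩)
  obtain ⟨e', v', hlead⟩ := exists_leadsAt (F := orbitSum e v) fun h0 => hne (by simp [h0])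
  have hs := hlead.isSortedPair (diagAct_orbitSum e v)
  obtain ⟨σ, hσ⟩ : ∃ σ : Equiv.Perm (Fin N), e.mapDomain σ = e' ∧ v' ∘ σ = v := by
    have := hlead.1
    rw [coeff_orbitSum, Nat.cast_ne_zero, Finset.card_ne_zero] at this
    simpa [Finset.Nonempty] using this
  have happ : ∀ k, e' (σ k) = e k := fun k => by
    rw [← hσ.1, Finsupp.mapDomain_apply σ.injective]
  let f : Fin N → ℕᵒᵈ ×ₗ Fin n := fun i => toLex (OrderDual.toDual (e' i), v' i)
  have hf : f ∘ σ = fun i => toLex (OrderDual.toDual (e i), v i) := by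
    funext i
    simp [f, happ, ← hσ.2]
  have heq : f ∘ σ = f ∘ (1 : Equiv.Perm (Fin N)) :=
    Tuple.unique_monotone (by rw [hf]; exact h) hs
  rw [hf] at heq
  have hpt : ∀ i, e i = e' i ∧ v i = v' i := fun i => by
    simpa [f] using congrFun heq i
  rw [show e = e' from Finsupp.ext fun i => (hpt i).1,
    show v = v' from funext fun i => (hpt i).2] at hlead ⊢
  exact hlead

lemma exists_isSymmetric_polyLeadsAt {N : ℕ} {l : Fin N →₀ ℕ} (hl : Antitone l) :
    ∃ p : MvPolynomial (Fin N) ℂ, p.IsSymmetric ∧ PolyLeadsAt p l := by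
  have hs : IsSortedPair l (0 : Fin N → Fin 1) := fun i j hij => by
    rw [Prod.Lex.toLex_le_toLex]
    rcases (hl hij).lt_or_eq with h | h
    · exact Or.inl (OrderDual.toDual_lt_toDual.mpr h)
    · exact Or.inr ⟨congrArg OrderDual.toDual h.symm, le_rfl⟩
  have hsymm : (orbitSum l (0 : Fin N → Fin 1) 0).IsSymmetric := fun σ => by
    have h := congrFun (diagAct_orbitSum l (0 : Fin N → Fin 1) σ) 0
    rwa [diagAct, Subsingleton.elim ((0 : Fin N → Fin 1) ∘ σ) 0] at h
  have hlead := leadsAt_orbitSum hs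
  refine ⟨_, hsymm, hlead.1, fun m hm => ?_⟩
  rcases wordKey_le_iff.mp (hlead.2 m 0 hm) with h | h
  · exact h.le
  · exact (congrArg toLex h.1).le

lemma PolyLeadsAt.mul_leadsAt {N n : ℕ} {p : MvPolynomial (Fin N) ℂ} {l : Fin N →₀ ℕ}
    (hp : PolyLeadsAt p l) {F : VN N n} {e : Fin N →₀ ℕ} {v : Fin N → Fin n}
    (hF : LeadsAt F e v) : LeadsAt (fun u => p * F u) (l + e) v := by
  classical
  have hexp : ∀ e' u, coeff e' (F u) ≠ 0 → toLex e' ≤ toLex e := fun e' u h => by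
    rcases wordKey_le_iff.mp (hF.2 e' u h) with h | h
    · exact h.le
    · exact (congrArg toLex h.1).le
  constructor
  · have hcoeff : coeff (l + e) (p * F v) = coeff l p * coeff e (F v) := by
      rw [coeff_mul]
      refine Finset.sum_eq_single_of_mem (l, e) (by simp) fun x hx hne => ?_
      by_contra hz
      have h1 := hp.2 _ (left_ne_zero_of_mul hz)
      have h2 := hexp _ _ (right_ne_zero_of_mul hz)
      rw [HasAntidiagonal.mem_antidiagonal] at hx
      have h3 : toLex x.1 + toLex x.2 = toLex l + toLex e := congrArg toLex hx
      obtain ⟨h4, h5⟩ := (add_eq_add_iff_eq_and_eq h1 h2).mp h3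
      exact hne (Prod.ext (toLex_inj.mp h4) (toLex_inj.mp h5))
    change coeff (l + e) (p * F v) ≠ 0
    rw [hcoeff]
    exact mul_ne_zero hp.1 hF.1
  · intro e' u h
    change coeff e' (p * F u) ≠ 0 at h
    rw [coeff_mul] at h
    obtain ⟨x, hx, hz⟩ := Finset.exists_ne_zero_of_sum_ne_zero h
    rw [HasAntidiagonal.mem_antidiagonal] at hx
    have h1 := hp.2 _ (left_ne_zero_of_mul hz)
    rw [wordKey_le_iff, ← hx]
    rcases wordKey_le_iff.mp (hF.2 _ _ (right_ne_zero_of_mul hz)) with h2 | ⟨h2, h3⟩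
    · exact Or.inl (add_lt_add_of_le_of_lt h1 h2)
    · rcases h1.lt_or_eq with h1 | h1
      · exact Or.inl (add_lt_add_of_lt_of_le h1 (congrArg toLex h2).le)
      · exact Or.inr ⟨by rw [toLex_inj.mp h1, h2], h3⟩

lemma descentExponent_castSucc {m n : ℕ} (w : Fin (m + 1) → Fin n) (i : Fin m) :
    descentExponent w i.castSucc =
      descentExponent w i.succ + if w i.succ < w i.castSucc then 1 else 0 := by
  classical
  simp only [descentExponent, Finsupp.equivFunOnFinite_symm_apply_apply]
  split_ifs with h
  · rw [← Finset.card_insert_of_notMem (a := i.castSucc)]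
    · congr 1
      ext j
      simp only [Finset.mem_filter, Finset.mem_univ, true_and, Finset.mem_insert]
      constructor
      · rintro ⟨hij, hj⟩
        rcases hij.eq_or_lt with rfl | hlt
        · exact Or.inl rfl
        · exact Or.inr ⟨Fin.castSucc_lt_iff_succ_le.mp hlt, hj⟩
      · rintro (rfl | ⟨hij, hj⟩)
        · exact ⟨le_rfl, by simp, h⟩
        · exact ⟨(Fin.castSucc_lt_iff_succ_le.mpr hij).le, hj⟩
    · simp
  · rw [add_zero]
    congr 1
    ext j
    simp only [Finset.mem_filter, Finset.mem_univ, true_and]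
    constructor
    · rintro ⟨hij, hj⟩
      rcases hij.eq_or_lt with rfl | hlt
      · obtain ⟨_, hj⟩ := hj
        exact absurd hj h
      · exact ⟨Fin.castSucc_lt_iff_succ_le.mp hlt, hj⟩
    · rintro ⟨hij, hj⟩
      exact ⟨(Fin.castSucc_lt_iff_succ_le.mpr hij).le, hj⟩

lemma descentExponent_last {m n : ℕ} (w : Fin (m + 1) → Fin n) :
    descentExponent w (Fin.last m) = 0 := by
  simp only [descentExponent, Finsupp.equivFunOnFinite_symm_apply_apply, Finset.card_eq_zero,
    Finset.filter_eq_empty_iff, Finset.mem_univ, true_imp_iff]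
  rintro j ⟨hj, h, -⟩
  obtain rfl := Fin.last_le_iff.mp hj
  simp at h

lemma isSortedPair_descentExponent {N n : ℕ} (w : Fin N → Fin n) :
    IsSortedPair (descentExponent w) w := by
  cases N with
  | zero => exact fun i => i.elim0
  | succ m =>
    refine Fin.monotone_iff_le_succ.mpr fun i => ?_
    rw [Prod.Lex.toLex_le_toLex]
    have hd := descentExponent_castSucc w i
    split_ifs at hd with h
    · exact Or.inl (OrderDual.toDual_lt_toDual.mpr (by omega))
    · exact Or.inr ⟨congrArg OrderDual.toDual (by omega), not_lt.mp h⟩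

lemma IsSortedPair.exists_antitone_add {N n : ℕ} {e : Fin N →₀ ℕ} {w : Fin N → Fin n}
    (h : IsSortedPair e w) :
    ∃ l : Fin N →₀ ℕ, Antitone l ∧ l + descentExponent w = e := by
  cases N with
  | zero => exact ⟨0, fun i => i.elim0, Finsupp.ext fun i => i.elim0⟩
  | succ m =>
    have hanti : Antitone fun i => (e i : ℤ) - descentExponent w i := by
      refine Fin.antitone_iff_succ_le.mpr fun i => ?_
      have hd := descentExponent_castSucc w i
      have he := h (Fin.castSucc_lt_succ (i := i)).le
      rw [Prod.Lex.toLex_le_toLex] at he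
      simp only [OrderDual.toDual_lt_toDual, OrderDual.toDual_inj] at he
      split_ifs at hd with hlt
      · have : e i.succ < e i.castSucc := he.resolve_right fun h' => not_lt.mpr h'.2 hlt
        omega
      · have : e i.succ ≤ e i.castSucc := he.elim le_of_lt fun h' => h'.1.ge
        omega
    have hle : ∀ i, descentExponent w i ≤ e i := fun i => by
      have := hanti (Fin.le_last i)
      simp only [descentExponent_last] at this
      omega
    refine ⟨e - descentExponent w, fun i j hij => ?_, tsub_add_cancel_of_le hle⟩
    have h1 := hanti hij
    have h2 := hle i
    have h3 := hle j
    simp only [Finsupp.coe_tsub, Pi.sub_apply]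
    simp only at h1
    omega

/-- The basis vector attached to `w`. -/
noncomputable def descentBasis {N n : ℕ} (w : Fin N → Fin n) : VN N n :=
  orbitSum (descentExponent w) w

lemma leadsAt_descentBasis {N n : ℕ} (w : Fin N → Fin n) :
    LeadsAt (descentBasis w) (descentExponent w) w :=
  leadsAt_orbitSum (isSortedPair_descentExponent w)

lemma diagAct_sub {N n : ℕ} (σ : Equiv.Perm (Fin N)) (F G : VN N n) :
    diagAct σ (F - G) = diagAct σ F - diagAct σ G := by
  funext w
  simp [diagAct]

lemma diagAct_mul {N n : ℕ} (σ : Equiv.Perm (Fin N)) {p : MvPolynomial (Fin N) ℂ}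
    (hp : p.IsSymmetric) (F : VN N n) :
    diagAct σ (fun u => p * F u) = fun u => p * diagAct σ F u := by
  funext w
  simp [diagAct, hp σ]

lemma exists_coeffs_of_invariant {N n : ℕ} (F : VN N n) (hF : ∀ σ, diagAct σ F = F) :
    ∃ c : (Fin N → Fin n) → MvPolynomial (Fin N) ℂ,
      (∀ w, (c w).IsSymmetric) ∧ F = fun v => ∑ w, c w * descentBasis w v := by
  classical
  by_cases h0 : F = 0
  · exact ⟨0, fun w => IsSymmetric.zero, by simp [h0, funext_iff]⟩
  obtain ⟨e, v, hlead⟩ := exists_leadsAt h0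
  obtain ⟨k, hk⟩ : ∃ k, k = wordKey e v := ⟨_, rfl⟩
  induction k using WellFoundedLT.induction generalizing F e v with
  | ind k ih =>
  subst hk
  obtain ⟨l, hl, rfl⟩ := (hlead.isSortedPair hF).exists_antitone_add
  obtain ⟨p, hp, hpl⟩ := exists_isSymmetric_polyLeadsAt hl
  have hmul := hpl.mul_leadsAt (leadsAt_descentBasis v)
  set e := l + descentExponent v
  set a := coeff e (F v) / coeff e (p * descentBasis v v) with ha
  have hq : (C a * p).IsSymmetric := (IsSymmetric.C a).mul hp
  set G : VN N n := F - fun u => (C a * p) * descentBasis v u with hG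
  have hGinv : ∀ σ, diagAct σ G = G := fun σ => by
    rw [hG, diagAct_sub, diagAct_mul σ hq, hF σ, descentBasis, diagAct_orbitSum]
  have hcoeff : ∀ e' u, coeff e' (G u) =
      coeff e' (F u) - a * coeff e' (p * descentBasis v u) := fun e' u => by
    simp [hG, mul_assoc]
  have hGv : coeff e (G v) = 0 := by
    rw [hcoeff, ha, div_mul_cancel₀ _ hmul.1, sub_self]
  have hGc : ∃ c : (Fin N → Fin n) → MvPolynomial (Fin N) ℂ,
      (∀ w, (c w).IsSymmetric) ∧ G = fun v => ∑ w, c w * descentBasis w v := by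
    by_cases hG0 : G = 0
    · exact ⟨0, fun w => IsSymmetric.zero, by simp [hG0, funext_iff]⟩
    obtain ⟨e', v', hlead'⟩ := exists_leadsAt hG0
    refine ih _ (lt_of_le_of_ne ?_ fun heq => ?_) G hGinv hG0 e' v' hlead' rfl
    · by_cases hF' : coeff e' (F v') = 0
      · refine hmul.2 e' v' fun hz => hlead'.1 ?_
        change coeff e' (p * descentBasis v v') = 0 at hz
        rw [hcoeff, hF', hz, mul_zero, sub_zero]
      · exact hlead.2 e' v' hF'
    · obtain ⟨h1, h2⟩ := wordKey_injective heq
      exact hlead'.1 (by rw [h1, h2, hGv])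
  obtain ⟨c, hc, hcG⟩ := hGc
  refine ⟨c + Pi.single v (C a * p), fun w => (hc w).add ?_, ?_⟩
  · rcases eq_or_ne w v with rfl | hwv
    · simpa using hq
    · rw [Pi.single_eq_of_ne hwv]
      exact IsSymmetric.zero
  · funext u
    have hu := congrFun hcG u
    have hGu : G u = F u - (C a * p) * descentBasis v u := rfl
    have hsingle : ∑ w, (Pi.single v (C a * p) : (Fin N → Fin n) → MvPolynomial (Fin N) ℂ) w *
        descentBasis w u = (C a * p) * descentBasis v u := by
      rw [Finset.sum_eq_single_of_mem v (Finset.mem_univ v)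
        fun w _ hw => by rw [Pi.single_eq_of_ne hw, zero_mul], Pi.single_eq_same]
    simp only [Pi.add_apply, add_mul, Finset.sum_add_distrib, hsingle]
    rw [← hu, hGu, sub_add_cancel]

lemma descentBasis_linearIndependent {N n : ℕ}
    (c : (Fin N → Fin n) → MvPolynomial (Fin N) ℂ)
    (hc : ∀ v : Fin N → Fin n, ∑ w, c w * descentBasis w v = 0) : c = 0 := by
  classical
  by_contra hne
  obtain ⟨w₀, hw₀⟩ := Function.ne_iff.mp hne
  have hlead : ∀ w, ∃ e, c w ≠ 0 → LeadsAt (fun u => c w * descentBasis w u) e w := fun w => by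
    by_cases hw : c w = 0
    · exact ⟨0, fun h => absurd hw h⟩
    · obtain ⟨l, hl⟩ := exists_polyLeadsAt hw
      exact ⟨_, fun _ => hl.mul_leadsAt (leadsAt_descentBasis w)⟩
  choose e he using hlead
  obtain ⟨w, hw, hmax⟩ := Finset.exists_max_image {w | c w ≠ 0} (fun w => wordKey (e w) w)
    ⟨w₀, by simpa using hw₀⟩
  simp only [Finset.mem_filter, Finset.mem_univ, true_and] at hw hmax
  have hsum := congrArg (coeff (e w)) (hc w)
  rw [coeff_sum, coeff_zero, Finset.sum_eq_single_of_mem w (Finset.mem_univ w)] at hsum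
  · exact (he w hw).1 hsum
  · intro x _ hxw
    by_contra hz
    have hx : c x ≠ 0 := fun h => hz (by simp [h])
    exact hxw (wordKey_injective (le_antisymm (hmax x hx) ((he x hx).2 _ _ hz))).2

/-- The space of `S_N`-invariants of
`π^{⊗N} ⊗ ℂ[z_1,…,z_N]` (diagonal action) is a free module of rank `n^N` over
the ring of symmetric polynomials: there are `n^N` invariant vectors `b w`
(indexed by words `w : Fin N → Fin n`) such that every invariant `F` is, in a
unique way, a combination of the `b w` with symmetric-polynomial
coefficients. -/
theorem invariants_free_over_symmetric (N n : ℕ) :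
    ∃ b : (Fin N → Fin n) → VN N n,
      (∀ w σ, diagAct σ (b w) = b w) ∧
      ∀ F : VN N n, (∀ σ, diagAct σ F = F) →
        ∃! c : (Fin N → Fin n) → MvPolynomial (Fin N) ℂ,
          (∀ w, (c w).IsSymmetric) ∧ F = fun v => ∑ w, c w * b w v := by
  refine ⟨descentBasis, fun w σ => diagAct_orbitSum _ _ σ, fun F hF => ?_⟩
  obtain ⟨c, hc, hFc⟩ := exists_coeffs_of_invariant F hF
  refine ⟨c, ⟨hc, hFc⟩, fun c' hc' => sub_eq_zero.mp ?_⟩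
  refine descentBasis_linearIndependent _ fun v => ?_
  simp only [Pi.sub_apply, sub_mul, Finset.sum_sub_distrib]
  exact sub_eq_zero.mpr (congrFun (hc'.2.symm.trans hFc) v)
end
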